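/- arXiv:2506.01107 — 2 statements merged into one kernel-verified Lean document; each statement's English description precedes it below -/
import Mathlib

section
/- Let c ≥ 2 be a real constant. There is a constant C > 0 depending only on c such that for every n ≥ 3 and every integer m with 1 < m < n/2, the MMAHH with acceptance operators OI and AM on Jump_m with switching probabilities q = 1/2 and p = m·q/(c·n), started from x_0 uniformly distributed on {0,1}^n and s_0 = OI, has runtime T satisfying E[T] ≤ C·(n² + 2^{m−2}·n^{m+1}/(m−1)!); in particular E[T] = O(n^{m+1}). -/
open MeasureTheory
open scoped ENNReal NNReal

namespace MMAHHStmt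

/-- The two acceptance operators. -/
inductive Op : Type
  | OI : Op
  | AM : Op
  deriving DecidableEq

instance : MeasurableSpace Op := ⊤

/-- Search points: bit-strings of length `n`. -/
abbrev Point (n : ℕ) := Fin n → Bool

/-- The number of one-bits of a bit-string. -/
def ones {n : ℕ} (x : Point n) : ℕ := (Finset.univ.filter fun i => x i = true).card

/-- The all-ones string, the global optimum of all benchmarks considered. -/
def optimum (n : ℕ) : Point n := fun _ => true

/-- Flipping the bit in position `v`. -/
def flipBit {n : ℕ} (x : Point n) (v : Fin n) : Point n := Function.update x v (!(x v))

open Classical in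
/-- The search point obtained from `x` by proposing to flip bit `v` and applying the
acceptance operator `op` for the objective function `f`. -/
noncomputable def movedPoint {n : ℕ} (f : Point n → ℝ) (op : Op) (x : Point n) (v : Fin n) :
    Point n :=
  match op with
  | Op.OI => if f x < f (flipBit x v) then flipBit x v else x
  | Op.AM => flipBit x v

open Classical in
/-- One-step transition probability of the search point under acceptance operator `op`:
a uniformly random bit is flipped and the move is accepted or rejected according to `op`. -/
noncomputable def moveProb {n : ℕ} (f : Point n → ℝ) (op : Op) (x x' : Point n) : ℝ≥0∞ :=
  ((Finset.univ.filter fun v => movedPoint f op x v = x').card : ℝ≥0∞) / n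

/-- Transition probabilities of the two-state Markov chain on the acceptance operators. -/
noncomputable def switchProb (p q : ℝ) : Op → Op → ℝ≥0∞
  | Op.OI, Op.OI => ENNReal.ofReal (1 - p)
  | Op.OI, Op.AM => ENNReal.ofReal p
  | Op.AM, Op.OI => ENNReal.ofReal q
  | Op.AM, Op.AM => ENNReal.ofReal (1 - q)

/-- One-step transition probabilities of the MMAHH on the state space
`Point n × Op`: the search point moves according to the current acceptance operator, and,
independently, the operator switches according to the two-state Markov chain. -/
noncomputable def mmahhTrans {n : ℕ} (f : Point n → ℝ) (p q : ℝ) :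
    Point n × Op → Point n × Op → ℝ≥0∞ :=
  fun s s' => moveProb f s.2 s.1 s'.1 * switchProb p q s.2 s'.2

/-- `X` is (a version of) the MMAHH Markov chain with objective function `f` and switching
probabilities `p` and `q`, under the measure `μ`: each `X t` is measurable, and conditionally
on any history, the next state is distributed according to `mmahhTrans`. -/
def IsMMAHH {n : ℕ} {Ω : Type*} [MeasurableSpace Ω] (μ : Measure Ω)
    (X : ℕ → Ω → Point n × Op) (f : Point n → ℝ) (p q : ℝ) : Prop :=
  (∀ t, Measurable (X t)) ∧
  ∀ (t : ℕ) (σ : ℕ → Point n × Op) (s' : Point n × Op),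
    μ {ω | (∀ i ≤ t, X i ω = σ i) ∧ X (t + 1) ω = s'}
      = μ {ω | ∀ i ≤ t, X i ω = σ i} * mmahhTrans f p q (σ t) s'

/-- The runtime: the first hitting time of the global optimum, as an extended natural number
(`⊤` if the optimum is never reached). -/
noncomputable def hitTime {n : ℕ} {Ω : Type*} (X : ℕ → Ω → Point n × Op) (ω : Ω) : ℕ∞ :=
  ⨅ t ∈ {t : ℕ | (X t ω).1 = optimum n}, (t : ℕ∞)

/-- The `k`-th switching time between the two acceptance operators (with junk value given by
`Nat.sInf ∅ = 0` on the probability-zero event that no further switch occurs). -/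
noncomputable def switchTime {n : ℕ} {Ω : Type*} (X : ℕ → Ω → Point n × Op) : ℕ → Ω → ℕ
  | 0, _ => 0
  | k + 1, ω =>
      sInf {t : ℕ | switchTime X k ω ≤ t ∧ (X t ω).2 ≠ (X (switchTime X k ω) ω).2}

/-- The Jump benchmark with gap parameter `m`. -/
noncomputable def Jump (n m : ℕ) (x : Point n) : ℝ :=
  if ones x ≤ n - m ∨ ones x = n then (m : ℝ) + (ones x : ℝ) else (n : ℝ) - (ones x : ℝ)

instance instFintypeOp : Fintype Op := ⟨{Op.OI, Op.AM}, fun x => by cases x <;> simp⟩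

instance instMSCOp : MeasurableSingletonClass Op := ⟨fun _ => trivial⟩

lemma sum_op {M : Type*} [AddCommMonoid M] (F : Op → M) : ∑ o, F o = F Op.OI + F Op.AM := by
  show ∑ o ∈ ({Op.OI, Op.AM} : Finset Op), F o = _
  rw [Finset.sum_pair (by simp)]

/-- Markov property restricted to histories avoiding the target set. -/
lemma markov_step {S Ω : Type*} [Fintype S] [MeasurableSpace S] [MeasurableSingletonClass S]
    [MeasurableSpace Ω] (μ : Measure Ω) (X : ℕ → Ω → S) (P : S → S → ℝ≥0∞)
    (hX : ∀ t, Measurable (X t))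
    (hM : ∀ (t : ℕ) (σ : ℕ → S) (s' : S), μ {ω | (∀ i ≤ t, X i ω = σ i) ∧ X (t + 1) ω = s'}
      = μ {ω | ∀ i ≤ t, X i ω = σ i} * P (σ t) s') (A : Set S) (t : ℕ) (s s' : S) :
    μ {ω | ((∀ i ≤ t, X i ω ∉ A) ∧ X t ω = s) ∧ X (t + 1) ω = s'}
      = μ {ω | (∀ i ≤ t, X i ω ∉ A) ∧ X t ω = s} * P s s' := by
  classical
  let ext : (Fin (t + 1) → S) → ℕ → S := fun τ i => if h : i < t + 1 then τ ⟨i, h⟩ else s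
  let I : Finset (Fin (t + 1) → S) :=
    Finset.univ.filter fun τ => (∀ i, τ i ∉ A) ∧ τ (Fin.last t) = s
  have key : ∀ (τ : Fin (t + 1) → S) (ω : Ω),
      (∀ i ≤ t, X i ω = ext τ i) ↔ τ = fun i : Fin (t + 1) => X i ω := by
    intro τ ω
    constructor
    · intro h
      funext i
      have := h i (Nat.lt_succ_iff.mp i.2)
      simp only [ext, i.2, dif_pos] at this
      exact this.symm
    · rintro rfl i hi
      have h' : i < t + 1 := Nat.lt_succ_iff.mpr hi
      simp only [ext, dif_pos h']
  have hmeas : ∀ τ : Fin (t + 1) → S, MeasurableSet {ω | ∀ i ≤ t, X i ω = ext τ i} := by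
    intro τ
    have : {ω | ∀ i ≤ t, X i ω = ext τ i} = ⋂ i, ⋂ (_ : i ≤ t), X i ⁻¹' {ext τ i} := by
      ext ω; simp
    rw [this]
    exact MeasurableSet.iInter fun i => MeasurableSet.iInter fun _ =>
      hX i (measurableSet_singleton _)
  have hmem : ∀ ω, ((∀ i ≤ t, X i ω ∉ A) ∧ X t ω = s) ↔
      (fun i : Fin (t + 1) => X i ω) ∈ I := by
    intro ω
    simp only [I, Finset.mem_filter, Finset.mem_univ, true_and, Fin.val_last]
    refine and_congr_left fun _ => ?_
    exact ⟨fun h i => h i (Nat.lt_succ_iff.mp i.2), fun h i hi => h ⟨i, Nat.lt_succ_iff.mpr hi⟩⟩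
  have e1 : {ω | (∀ i ≤ t, X i ω ∉ A) ∧ X t ω = s}
      = ⋃ τ ∈ I, {ω | ∀ i ≤ t, X i ω = ext τ i} := by
    ext ω
    simp only [Set.mem_ofPred_eq, Set.mem_iUnion, key, exists_prop, hmem]
    constructor
    · intro h; exact ⟨_, h, rfl⟩
    · rintro ⟨τ, h, rfl⟩; exact h
  have e2 : {ω | ((∀ i ≤ t, X i ω ∉ A) ∧ X t ω = s) ∧ X (t + 1) ω = s'}
      = ⋃ τ ∈ I, {ω | (∀ i ≤ t, X i ω = ext τ i) ∧ X (t + 1) ω = s'} := by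
    ext ω
    simp only [Set.mem_ofPred_eq, Set.mem_iUnion, key, exists_prop, hmem]
    constructor
    · rintro ⟨h, h'⟩; exact ⟨_, h, rfl, h'⟩
    · rintro ⟨τ, h, rfl, h'⟩; exact ⟨h, h'⟩
  rw [e1, e2, measure_biUnion_finset, measure_biUnion_finset, Finset.sum_mul]
  · refine Finset.sum_congr rfl fun τ hτ => ?_
    rw [hM]
    have : ext τ t = s := by
      have h := (Finset.mem_filter.mp hτ).2.2
      simp only [ext, Nat.lt_succ_self, dif_pos]
      exact h
    rw [this]
  · intro τ _ τ' _ hne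
    refine Set.disjoint_left.mpr fun ω h h' => hne ?_
    rw [(key τ ω).mp h, (key τ' ω).mp h']
  · intro τ _; exact hmeas τ
  · intro τ _ τ' _ hne
    refine Set.disjoint_left.mpr fun ω h h' => hne ?_
    rw [(key τ ω).mp h.1, (key τ' ω).mp h'.1]
  · intro τ _
    exact (hmeas τ).inter (hX (t + 1) (measurableSet_singleton s'))

/-- Decomposition of an event by the value of a finite-valued random variable. -/
lemma measure_split {S Ω : Type*} [Fintype S] [MeasurableSpace S] [MeasurableSingletonClass S]
    [MeasurableSpace Ω] (μ : Measure Ω) (Y : Ω → S) (hY : Measurable Y) (E : Set Ω) :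
    μ E = ∑ s, μ {ω | ω ∈ E ∧ Y ω = s} := by
  classical
  have h := sum_measure_preimage_singleton (μ := μ.restrict E) (f := Y) Finset.univ
    (fun y _ => hY (measurableSet_singleton y))
  simp only [Finset.coe_univ, Set.preimage_univ, Measure.restrict_apply_univ] at h
  rw [← h]
  refine Finset.sum_congr rfl fun s _ => ?_
  rw [Measure.restrict_apply (hY (measurableSet_singleton s))]
  congr 1
  ext ω
  simp [and_comm]

/-- Additive drift bound. -/
lemma drift_sum {S Ω : Type*} [Fintype S] [MeasurableSpace S] [MeasurableSingletonClass S]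
    [MeasurableSpace Ω] (μ : Measure Ω) [IsProbabilityMeasure μ] (X : ℕ → Ω → S)
    (P : S → S → ℝ≥0∞)
    (hX : ∀ t, Measurable (X t))
    (hM : ∀ (t : ℕ) (σ : ℕ → S) (s' : S), μ {ω | (∀ i ≤ t, X i ω = σ i) ∧ X (t + 1) ω = s'}
      = μ {ω | ∀ i ≤ t, X i ω = σ i} * P (σ t) s') (A : Set S)
    (g : S → ℝ≥0∞) (B : ℝ≥0∞) (hB : ∀ s, g s ≤ B)
    (hg : ∀ s, s ∉ A → 1 + ∑ s', P s s' * g s' ≤ g s) :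
    ∑' t, μ {ω | ∀ i ≤ t, X i ω ∉ A} ≤ B := by
  classical
  set a : ℕ → S → ℝ≥0∞ := fun t s => μ {ω | (∀ i ≤ t, X i ω ∉ A) ∧ X t ω = s} with ha
  have hsum : ∀ t, μ {ω | ∀ i ≤ t, X i ω ∉ A} = ∑ s, a t s := fun t =>
    measure_split μ (X t) (hX t) _
  have hzero : ∀ t s, s ∈ A → a t s = 0 := by
    intro t s hs
    have : {ω | (∀ i ≤ t, X i ω ∉ A) ∧ X t ω = s} = ∅ := by
      ext ω
      simp only [Set.mem_ofPred_eq, Set.mem_empty_iff_false, iff_false]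
      rintro ⟨h, rfl⟩
      exact h t le_rfl hs
    simp [ha, this]
  have hstep : ∀ t s', a (t + 1) s' ≤ ∑ s, a t s * P s s' := by
    intro t s'
    have h1 : a (t + 1) s' ≤ μ {ω | (∀ i ≤ t, X i ω ∉ A) ∧ X (t + 1) ω = s'} :=
      measure_mono fun ω h => ⟨fun i hi => h.1 i (by omega), h.2⟩
    refine h1.trans ?_
    rw [measure_split μ (X t) (hX t)]
    refine Finset.sum_le_sum fun s _ => ?_
    rw [← markov_step μ X P hX hM A t s s']
    refine measure_mono ?_
    rintro ω ⟨⟨h1, h2⟩, h3⟩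
    exact ⟨⟨h1, h3⟩, h2⟩
  have hdrift : ∀ t, ∑ s, a (t + 1) s * g s + ∑ s, a t s ≤ ∑ s, a t s * g s := by
    intro t
    calc ∑ s, a (t + 1) s * g s + ∑ s, a t s
        ≤ ∑ s', (∑ s, a t s * P s s') * g s' + ∑ s, a t s := by
          gcongr with s' _; exact hstep t s'
      _ = ∑ s, a t s * (1 + ∑ s', P s s' * g s') := by
          simp_rw [Finset.sum_mul, mul_add, mul_one, Finset.mul_sum]
          rw [Finset.sum_comm, Finset.sum_add_distrib, add_comm]
          simp_rw [mul_assoc]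
      _ ≤ ∑ s, a t s * g s := by
          refine Finset.sum_le_sum fun s _ => ?_
          by_cases hs : s ∈ A
          · simp [hzero t s hs]
          · gcongr; exact hg s hs
  have hN : ∀ N, ∑ s, a N s * g s + ∑ t ∈ Finset.range N, ∑ s, a t s ≤ ∑ s, a 0 s * g s := by
    intro N
    induction N with
    | zero => simp
    | succ N ih =>
      rw [Finset.sum_range_succ]
      calc _ = (∑ s, a (N + 1) s * g s + ∑ s, a N s) + ∑ t ∈ Finset.range N, ∑ s, a t s := by
            ring
        _ ≤ _ := by gcongr; exact hdrift N
        _ ≤ _ := ih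
  have h0 : ∑ s, a 0 s * g s ≤ B := by
    calc ∑ s, a 0 s * g s ≤ ∑ s, a 0 s * B := by gcongr with s _; exact hB s
      _ = μ {ω | ∀ i ≤ 0, X i ω ∉ A} * B := by rw [← Finset.sum_mul, hsum]
      _ ≤ 1 * B := by gcongr; exact prob_le_one
      _ = B := one_mul B
  rw [ENNReal.tsum_eq_iSup_nat]
  refine iSup_le fun N => ?_
  simp_rw [hsum]
  exact (le_add_self.trans (hN N)).trans h0

lemma hit_eq_tsum {n : ℕ} {Ω : Type*} (X : ℕ → Ω → Point n × Op) (ω : Ω) :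
    (hitTime X ω : ℝ≥0∞)
      = ∑' t, Set.indicator {ω | ∀ i ≤ t, X i ω ∉ {s : Point n × Op | s.1 = optimum n}} 1 ω := by
  classical
  by_cases hex : ∃ t, (X t ω).1 = optimum n
  · set k := Nat.find hex with hk
    have hh : hitTime X ω = (k : ℕ∞) := by
      unfold hitTime
      apply le_antisymm
      · exact iInf₂_le k (Nat.find_spec hex)
      · refine le_iInf₂ fun t ht => ?_
        exact_mod_cast Nat.find_min' hex ht
    have hind : ∀ t, Set.indicator
        {ω | ∀ i ≤ t, X i ω ∉ {s : Point n × Op | s.1 = optimum n}} (1 : Ω → ℝ≥0∞) ω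
        = if t < k then 1 else 0 := by
      intro t
      rw [Set.indicator_apply]
      refine if_congr ?_ rfl rfl
      simp only [Set.mem_ofPred_eq, hk, Nat.lt_find_iff]
    simp_rw [hind, hh]
    rw [tsum_eq_sum (s := Finset.range k) (by intro b hb; simpa using hb)]
    rw [Finset.sum_congr rfl (g := fun _ => (1 : ℝ≥0∞))
      (by intro t ht; simp [Finset.mem_range.mp ht])]
    simp
  · have hind : ∀ t, Set.indicator
        {ω | ∀ i ≤ t, X i ω ∉ {s : Point n × Op | s.1 = optimum n}} (1 : Ω → ℝ≥0∞) ω = 1 := by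
      intro t
      rw [Set.indicator_of_mem]
      · rfl
      · intro i _ h
        exact hex ⟨i, h⟩
    simp_rw [hind]
    rw [ENNReal.tsum_const_eq_top_of_ne_zero one_ne_zero]
    have hh : hitTime X ω = ⊤ := by
      unfold hitTime
      simp only [Set.mem_ofPred_eq, iInf_eq_top]
      intro t ht
      exact absurd ⟨t, ht⟩ hex
    rw [hh]; rfl

lemma hit_bound {n : ℕ} {Ω : Type*} [MeasurableSpace Ω] (μ : Measure Ω) [IsProbabilityMeasure μ]
    (X : ℕ → Ω → Point n × Op) (f : Point n → ℝ) (p q : ℝ) (h : IsMMAHH μ X f p q)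
    (g : Point n × Op → ℝ≥0∞) (B : ℝ≥0∞) (hB : ∀ s, g s ≤ B)
    (hg : ∀ s, s.1 ≠ optimum n → 1 + ∑ s', mmahhTrans f p q s s' * g s' ≤ g s) :
    ∫⁻ ω, (hitTime X ω : ℝ≥0∞) ∂μ ≤ B := by
  have hm : ∀ t, MeasurableSet
      {ω | ∀ i ≤ t, X i ω ∉ {s : Point n × Op | s.1 = optimum n}} := by
    intro t
    have : {ω | ∀ i ≤ t, X i ω ∉ {s : Point n × Op | s.1 = optimum n}}
        = ⋂ i, ⋂ (_ : i ≤ t), X i ⁻¹' {s : Point n × Op | s.1 = optimum n}ᶜ := by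
      ext ω; simp
    rw [this]
    exact MeasurableSet.iInter fun i => MeasurableSet.iInter fun _ =>
      h.1 i (Set.toFinite _).measurableSet
  simp_rw [hit_eq_tsum]
  rw [lintegral_tsum]
  · simp_rw [lintegral_indicator_one (hm _)]
    exact drift_sum μ X _ h.1 h.2 _ g B hB hg
  · intro t
    exact (measurable_one.indicator (hm t)).aemeasurable

/-- number of zero bits -/
def zeros {n : ℕ} (x : Point n) : ℕ := (Finset.univ.filter fun i => x i = false).card

lemma ones_add_zeros {n : ℕ} (x : Point n) : ones x + zeros x = n := by
  have := Finset.card_filter_add_card_filter_not (s := (Finset.univ : Finset (Fin n)))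
    (fun i => x i = true)
  simpa [ones, zeros] using this

lemma zeros_eq_zero {n : ℕ} {x : Point n} (h : zeros x = 0) : x = optimum n := by
  funext i
  have : i ∉ Finset.univ.filter fun i => x i = false := by
    rw [Finset.card_eq_zero.mp h]; simp
  simpa [optimum] using this

lemma zeros_flip_false {n : ℕ} {x : Point n} {v : Fin n} (h : x v = false) :
    zeros (flipBit x v) + 1 = zeros x := by
  have : (Finset.univ.filter fun i => flipBit x v i = false)
      = (Finset.univ.filter fun i => x i = false).erase v := by
    ext i
    by_cases hi : i = v
    · subst hi; simp [flipBit, h]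
    · have hf : flipBit x v i = x i := Function.update_of_ne hi _ _
      simp [hf, hi]
  unfold zeros
  rw [this]
  exact Finset.card_erase_add_one (by simp [h])

lemma zeros_flip_true {n : ℕ} {x : Point n} {v : Fin n} (h : x v = true) :
    zeros (flipBit x v) = zeros x + 1 := by
  have : (Finset.univ.filter fun i => flipBit x v i = false)
      = insert v (Finset.univ.filter fun i => x i = false) := by
    ext i
    by_cases hi : i = v
    · subst hi; simp [flipBit, h]
    · have hf : flipBit x v i = x i := Function.update_of_ne hi _ _
      simp [hf, hi]
  unfold zeros
  rw [this]
  exact Finset.card_insert_of_notMem (by simp [h])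

lemma sum_bits {n : ℕ} (x : Point n) (F : Fin n → ℝ) (a b : ℝ)
    (ha : ∀ v, x v = false → F v ≤ a) (hb : ∀ v, x v = true → F v ≤ b) :
    ∑ v, F v ≤ zeros x * a + (n - zeros x) * b := by
  have h : ∑ v, F v ≤ ∑ v, if x v = false then a else b := by
    refine Finset.sum_le_sum fun v _ => ?_
    cases hv : x v
    · simpa using ha v hv
    · simpa using hb v hv
  refine h.trans (le_of_eq ?_)
  rw [Finset.sum_ite, Finset.sum_const, Finset.sum_const, nsmul_eq_mul, nsmul_eq_mul]
  have h2 := ones_add_zeros x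
  have h3 : (ones x : ℝ) = n - zeros x := by
    rw [eq_sub_iff_add_eq]; exact_mod_cast h2
  rw [← h3]
  simp [zeros, ones]

/-- real switching probabilities -/
def sw (p q : ℝ) : Op → Op → ℝ
  | Op.OI, Op.OI => 1 - p
  | Op.OI, Op.AM => p
  | Op.AM, Op.OI => q
  | Op.AM, Op.AM => 1 - q

lemma trans_sum {n : ℕ} (hn : 0 < n) (f : Point n → ℝ) (p q : ℝ) (hp : 0 ≤ p) (hp1 : p ≤ 1)
    (hq : 0 ≤ q) (hq1 : q ≤ 1) (G : Point n → Op → ℝ) (hG : ∀ x o, 0 ≤ G x o)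
    (s : Point n × Op) :
    ∑ s', mmahhTrans f p q s s' * ENNReal.ofReal (G s'.1 s'.2)
      = ENNReal.ofReal ((∑ v, (sw p q s.2 Op.OI * G (movedPoint f s.2 s.1 v) Op.OI
          + sw p q s.2 Op.AM * G (movedPoint f s.2 s.1 v) Op.AM)) / n) := by
  classical
  have hsw : ∀ o o', 0 ≤ sw p q o o' := by
    intro o o'; cases o <;> cases o' <;> simp only [sw] <;> linarith
  have hsw2 : ∀ o o', switchProb p q o o' = ENNReal.ofReal (sw p q o o') := by
    intro o o'; cases o <;> cases o' <;> rfl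
  have hnn : (0 : ℝ) < n := by exact_mod_cast hn
  set F : Point n → ℝ := fun x => sw p q s.2 Op.OI * G x Op.OI + sw p q s.2 Op.AM * G x Op.AM
    with hF
  have hF0 : ∀ x, 0 ≤ F x := fun x =>
    add_nonneg (mul_nonneg (hsw _ _) (hG _ _)) (mul_nonneg (hsw _ _) (hG _ _))
  rw [Fintype.sum_prod_type]
  have h1 : ∀ x : Point n, ∑ o, mmahhTrans f p q s (x, o) * ENNReal.ofReal (G x o)
      = (∑ v, if movedPoint f s.2 s.1 v = x then ENNReal.ofReal (F x) else 0) / n := by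
    intro x
    rw [sum_op]
    simp only [mmahhTrans, hsw2, hF]
    rw [ENNReal.ofReal_add (mul_nonneg (hsw _ _) (hG _ _)) (mul_nonneg (hsw _ _) (hG _ _)),
      ENNReal.ofReal_mul (hsw _ _), ENNReal.ofReal_mul (hsw _ _)]
    rw [← Finset.sum_filter, Finset.sum_const, nsmul_eq_mul]
    simp only [moveProb, div_eq_mul_inv]
    have : ∀ (i1 i2 : DecidablePred fun v => movedPoint f s.2 s.1 v = x),
      (@Finset.filter _ (fun v => movedPoint f s.2 s.1 v = x) i1 Finset.univ).card =
      (@Finset.filter _ (fun v => movedPoint f s.2 s.1 v = x) i2 Finset.univ).card := by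
      intro i1 i2; congr
    rw [this _ (fun a => Classical.propDecidable _)]
    ring
  simp_rw [h1]
  rw [ENNReal.ofReal_div_of_pos hnn, ENNReal.ofReal_natCast,
    ENNReal.ofReal_sum_of_nonneg (fun v _ => hF0 _)]
  simp_rw [div_eq_mul_inv]
  rw [← Finset.sum_mul, Finset.sum_comm]
  simp

/-- straight-descent probability -/
noncomputable def uu (n m y : ℕ) : ℝ :=
  if y ≤ m then (y.factorial : ℝ) / (2 ^ (y - 1) * n ^ y) else 0

lemma two_pow_le_fact (k : ℕ) : 2 ^ (k - 1) ≤ k.factorial := by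
  induction k with
  | zero => simp
  | succ k ih =>
    rcases Nat.eq_zero_or_pos k with rfl | hk
    · simp
    · obtain ⟨j, rfl⟩ : ∃ j, k = j + 1 := ⟨k - 1, by omega⟩
      simp only [Nat.add_sub_cancel] at ih ⊢
      rw [Nat.factorial_succ (j + 1), pow_succ]
      nlinarith [Nat.factorial_pos (j + 1)]

/-- The potential. -/
noncomputable def pot (n m : ℕ) (K L : ℝ) (y : ℕ) : Op → ℝ
  | Op.OI => if y = 0 then 0 else K + L * |(y : ℝ) - m|
  | Op.AM => if y = 0 then 0 else K * (1 - uu n m y) + L * (|(y : ℝ) - m| + 3)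

lemma uu_nonneg (n m y : ℕ) : 0 ≤ uu n m y := by
  unfold uu; split_ifs <;> positivity

lemma uu_le_one (n m y : ℕ) (hn : 0 < n) (hm : m ≤ n) : uu n m y ≤ 1 := by
  unfold uu
  split_ifs with h
  · rw [div_le_one (by positivity)]
    have h1 : (y.factorial : ℝ) ≤ (n : ℝ) ^ y := by
      have : y.factorial ≤ n ^ y :=
        (Nat.factorial_le_pow y).trans (Nat.pow_le_pow_left (h.trans hm) y)
      exact_mod_cast this
    have h2 : (1 : ℝ) ≤ 2 ^ (y - 1) := one_le_pow₀ (by norm_num)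
    have h3 : (0 : ℝ) < (n : ℝ) ^ y := by positivity
    nlinarith
  · norm_num

lemma uu_step (n m y : ℕ) (hn : 0 < n) (hy : 2 ≤ y) :
    n * uu n m y ≤ y * (uu n m (y - 1) / 2) := by
  obtain ⟨k, rfl⟩ : ∃ k, y = k + 2 := ⟨y - 2, by omega⟩
  by_cases h : k + 2 ≤ m
  · have h' : k + 2 - 1 ≤ m := by omega
    unfold uu
    rw [if_pos h, if_pos h']
    have e1 : k + 2 - 1 = k + 1 := rfl
    have e2 : k + 1 - 1 = k := rfl
    rw [e1, e2, Nat.factorial_succ (k + 1)]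
    apply le_of_eq
    push_cast
    field_simp
    ring
  · have := uu_nonneg n m (k + 2 - 1)
    have e : uu n m (k + 2) = 0 := if_neg h
    rw [e, mul_zero]
    positivity

lemma pot_nonneg (n m : ℕ) (K L : ℝ) (hK : 0 ≤ K) (hL : 0 ≤ L) (hn : 0 < n) (hm : m ≤ n)
    (y : ℕ) (o : Op) : 0 ≤ pot n m K L y o := by
  have := uu_le_one n m y hn hm
  have h1 : 0 ≤ 1 - uu n m y := by linarith
  cases o <;> simp only [pot] <;> split_ifs <;> positivity

lemma jump_ge {n m : ℕ} {x : Point n} (hm : m ≤ n) (h : m ≤ zeros x) :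
    Jump n m x = m + n - zeros x := by
  have h2 := ones_add_zeros x
  have h3 : (ones x : ℝ) + zeros x = n := by exact_mod_cast h2
  unfold Jump
  rw [if_pos (by left; omega)]
  linarith

lemma jump_lt {n m : ℕ} {x : Point n} (hm : m ≤ n) (h : zeros x < m) (h0 : 0 < zeros x) :
    Jump n m x = zeros x := by
  have h2 := ones_add_zeros x
  have h3 : (ones x : ℝ) + zeros x = n := by exact_mod_cast h2
  unfold Jump
  rw [if_neg (by omega)]
  linarith

lemma pot_drift {n m : ℕ} (c : ℝ) (hc : 2 ≤ c) (hn : 3 ≤ n) (hm : 1 < m) (hmn : 2 * m < n)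
    (p K L : ℝ) (hp : p = (m : ℝ) * (1 / 2) / (c * (n : ℝ))) (hL : L = 4 * n / m)
    (hK : 0 ≤ K) (hKp : K * p * uu n m m = 4) (x : Point n) (o : Op) (hx : x ≠ optimum n) :
    1 + (∑ v, (sw p (1 / 2) o Op.OI * pot n m K L (zeros (movedPoint (Jump n m) o x v)) Op.OI
          + sw p (1 / 2) o Op.AM * pot n m K L (zeros (movedPoint (Jump n m) o x v)) Op.AM)) / n
      ≤ pot n m K L (zeros x) o := by
  have hmR : (2 : ℝ) ≤ m := by exact_mod_cast hm
  have hmnR : 2 * (m : ℝ) ≤ n := by exact_mod_cast hmn.le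
  have hn0 : (0 : ℝ) < n := by linarith
  have hL0 : 0 < L := by rw [hL]; positivity
  have hL8 : 8 ≤ L := by
    rw [hL, le_div_iff₀ (by linarith)]; linarith
  have hp0 : 0 < p := by rw [hp]; positivity
  have hLp : 3 * (L * p) ≤ 3 := by
    have : L * p = 2 / c := by rw [hL, hp]; field_simp; ring
    rw [this]
    have : 2 / c ≤ 1 := by rw [div_le_one (by linarith)]; exact hc
    linarith
  have hLm : L * m = 4 * n := by rw [hL]; field_simp
  have hz0 : 0 < zeros x := Nat.pos_of_ne_zero fun h => hx (zeros_eq_zero h)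
  set y := zeros x with hy
  have hyR : (1 : ℝ) ≤ y := by exact_mod_cast hz0
  have hyn : y ≤ n := by have := ones_add_zeros x; omega
  have hynR : (y : ℝ) ≤ n := by exact_mod_cast hyn
  have hu := uu_nonneg n m
  have main : ∀ (F : Fin n → ℝ) (a b T : ℝ), (∀ v, x v = false → F v ≤ a) →
      (∀ v, x v = true → F v ≤ b) → n + (y * a + (n - y) * b) ≤ n * T →
      1 + (∑ v, F v) / n ≤ T := by
    intro F a b T ha hb h
    have h1 := sum_bits x F a b ha hb
    rw [← hy] at h1
    have h2 : (∑ v, F v) / n ≤ T - 1 := by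
      rw [div_le_iff₀ hn0]; linarith
    linarith
  cases o with
  | AM =>
    simp only [movedPoint, sw]
    set A := |(y : ℝ) - m| with hA
    have e : pot n m K L y Op.AM = K * (1 - uu n m y) + L * (A + 3) := by
      simp [pot, hz0.ne', hA]
    rw [e]
    set w : ℝ := if y = 1 then 1 else uu n m (y - 1) / 2 with hw
    have hwy : n * uu n m y ≤ y * w := by
      rw [hw]
      split_ifs with h1
      · rw [h1]
        simp only [uu]
        rw [if_pos hm.le]
        simp
        rw [mul_inv_cancel₀ hn0.ne']
      · exact uu_step n m y (by omega) (by omega)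
    refine main _ (K * (1 - w) + L * (A + 5 / 2)) (K + L * (A + 5 / 2)) _ ?_ ?_ ?_
    · intro v hv
      have hz := zeros_flip_false hv
      rw [← hy] at hz
      have hz' : zeros (flipBit x v) = y - 1 := by omega
      rw [hz']
      by_cases h1 : y = 1
      · simp [pot, h1, hw]
        positivity
      · have h2 : y - 1 ≠ 0 := by omega
        simp only [pot, h2, if_false, hw, h1]
        have : |((y - 1 : ℕ) : ℝ) - m| ≤ A + 1 := by
          rw [Nat.cast_sub hz0, hA]
          push_cast
          have := abs_sub (y - m : ℝ) 1
          rw [abs_one] at this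
          rwa [show (y : ℝ) - 1 - m = y - m - 1 by ring]
        nlinarith
    · intro v hv
      rw [zeros_flip_true hv, ← hy]
      simp only [pot, Nat.succ_ne_zero, if_false]
      have : |((y + 1 : ℕ) : ℝ) - m| ≤ A + 1 := by
        rw [hA]
        push_cast
        have := abs_add_le (y - m : ℝ) 1
        rw [abs_one] at this
        rwa [show (y : ℝ) + 1 - m = y - m + 1 by ring]
      have := mul_nonneg hK (hu (y + 1))
      nlinarith
    · have := mul_le_mul_of_nonneg_left hwy hK
      nlinarith
  | OI =>
    have e : pot n m K L y Op.OI = K + L * |(y : ℝ) - m| := by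
      simp [pot, hz0.ne']
    have hW : ∀ z : ℕ, z ≠ 0 → sw p (1 / 2) Op.OI Op.OI * pot n m K L z Op.OI
        + sw p (1 / 2) Op.OI Op.AM * pot n m K L z Op.AM
        = K + L * |(z : ℝ) - m| + 3 * (L * p) - K * p * uu n m z := by
      intro z hz
      simp only [sw, pot, hz, if_false]
      ring
    have hW' : ∀ z : ℕ, sw p (1 / 2) Op.OI Op.OI * pot n m K L z Op.OI
        + sw p (1 / 2) Op.OI Op.AM * pot n m K L z Op.AM
        ≤ K + L * |(z : ℝ) - m| + 3 * (L * p) := by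
      intro z
      by_cases hz : z = 0
      · simp [pot, hz]; positivity
      · rw [hW z hz]
        have := mul_nonneg (mul_nonneg hK hp0.le) (hu z)
        linarith
    rw [e]
    have hmn' : m ≤ n := by omega
    rcases lt_trichotomy y m with h | h | h
    · -- below the local optimum
      have hR : (y : ℝ) + 1 ≤ m := by exact_mod_cast h
      have ab : |(y : ℝ) - m| = m - y := by rw [abs_of_nonpos] <;> linarith
      refine main _ (K + L * (m - y) + 3 * (L * p)) (K + L * (m - y - 1) + 3 * (L * p)) _ ?_ ?_ ?_
      · intro v hv
        have hz := zeros_flip_false hv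
        rw [← hy] at hz
        by_cases h1 : y = 1
        · have hz' : zeros (flipBit x v) = 0 := by omega
          unfold movedPoint
          simp only
          split_ifs
          · simp only [hz', pot, if_true]
            have : 0 ≤ L * ((m : ℝ) - y) := mul_nonneg hL0.le (by linarith)
            have := mul_pos hL0 hp0
            linarith
          · refine (hW' _).trans ?_
            rw [← hy, ab]
        · have j1 : Jump n m x = y := jump_lt hmn' h hz0
          have j2 : Jump n m (flipBit x v) = zeros (flipBit x v) :=
            jump_lt hmn' (by omega) (by omega)
          have hzR : (zeros (flipBit x v) : ℝ) + 1 = y := by exact_mod_cast hz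
          have hmv : movedPoint (Jump n m) Op.OI x v = x := by
            unfold movedPoint
            simp only
            rw [if_neg]
            rw [j1, j2]; linarith
          rw [hmv]
          refine (hW' _).trans ?_
          rw [← hy, ab]
      · intro v hv
        have hz := zeros_flip_true hv
        rw [← hy] at hz
        have j1 : Jump n m x = y := jump_lt hmn' h hz0
        have hzR : (zeros (flipBit x v) : ℝ) = y + 1 := by exact_mod_cast hz
        have j2 : Jump n m x < Jump n m (flipBit x v) := by
          rw [j1]
          by_cases h2 : y + 1 < m
          · rw [jump_lt hmn' (by omega) (by omega), hzR]; linarith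
          · rw [jump_ge hmn' (by omega), hzR]; linarith
        have hmv : movedPoint (Jump n m) Op.OI x v = flipBit x v := by
          unfold movedPoint
          simp only
          rw [if_pos j2]
        rw [hmv]
        refine (hW' _).trans ?_
        rw [hzR, abs_of_nonpos (by linarith)]
        linarith
      · rw [ab]
        nlinarith
    · -- at the local optimum
      have hR : (y : ℝ) = m := by exact_mod_cast h
      have hmv : ∀ v, movedPoint (Jump n m) Op.OI x v = x := by
        intro v
        have j1 : Jump n m x = m + n - y := jump_ge hmn' h.ge
        unfold movedPoint
        simp only
        rw [if_neg]
        rw [j1, not_lt]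
        cases hv : x v
        · have hz := zeros_flip_false hv
          rw [← hy] at hz
          have hzR : (zeros (flipBit x v) : ℝ) + 1 = y := by exact_mod_cast hz
          rw [jump_lt hmn' (by omega) (by omega)]
          linarith
        · have hz := zeros_flip_true hv
          rw [← hy] at hz
          have hzR : (zeros (flipBit x v) : ℝ) = y + 1 := by exact_mod_cast hz
          rw [jump_ge hmn' (by omega)]
          linarith
      have hv : ∀ v, sw p (1 / 2) Op.OI Op.OI *
          pot n m K L (zeros (movedPoint (Jump n m) Op.OI x v)) Op.OI
        + sw p (1 / 2) Op.OI Op.AM *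
          pot n m K L (zeros (movedPoint (Jump n m) Op.OI x v)) Op.AM ≤ K - 1 := by
        intro v
        rw [hmv, ← hy, hW y hz0.ne', h, hKp]
        simp
        linarith
      refine main _ (K - 1) (K - 1) _ (fun v _ => hv v) (fun v _ => hv v) ?_
      rw [hR]
      simp
      linarith
    · -- above the local optimum
      have hR : (m : ℝ) + 1 ≤ y := by exact_mod_cast h
      have ab : |(y : ℝ) - m| = y - m := by rw [abs_of_nonneg]; linarith
      have j1 : Jump n m x = m + n - y := jump_ge hmn' h.le
      refine main _ (K + L * (y - m - 1) + 3 * (L * p)) (K + L * (y - m) + 3 * (L * p)) _ ?_ ?_ ?_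
      · intro v hv
        have hz := zeros_flip_false hv
        rw [← hy] at hz
        have hzR : (zeros (flipBit x v) : ℝ) + 1 = y := by exact_mod_cast hz
        have hmv : movedPoint (Jump n m) Op.OI x v = flipBit x v := by
          unfold movedPoint
          simp only
          rw [if_pos]
          rw [j1, jump_ge hmn' (by omega)]
          linarith
        rw [hmv]
        refine (hW' _).trans ?_
        rw [abs_of_nonneg (by linarith)]
        nlinarith
      · intro v hv
        have hz := zeros_flip_true hv
        rw [← hy] at hz
        have hzR : (zeros (flipBit x v) : ℝ) = y + 1 := by exact_mod_cast hz
        have hmv : movedPoint (Jump n m) Op.OI x v = x := by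
          unfold movedPoint
          simp only
          rw [if_neg]
          rw [j1, jump_ge hmn' (by omega)]
          linarith
        rw [hmv]
        refine (hW' _).trans ?_
        rw [← hy, ab]
      · rw [ab]
        nlinarith

/-- Runtime of the MMAHH with OI+AM on `Jump_m` for `q = 1/2`, `p = m·q/(c·n)`. -/
theorem mmahh_oi_am_jump_q_half (c : ℝ) (hc : 2 ≤ c) :
    ∃ C : ℝ, 0 < C ∧
      ∀ (n m : ℕ), 3 ≤ n → 1 < m → 2 * m < n →
        ∀ (Ω : Type) [MeasurableSpace Ω] (μ : Measure Ω) (X : ℕ → Ω → Point n × Op),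
          IsProbabilityMeasure μ →
          IsMMAHH μ X (Jump n m) ((m : ℝ) * (1 / 2) / (c * (n : ℝ))) (1 / 2) →
          (∀ x0 : Point n, μ {ω | X 0 ω = (x0, Op.OI)} = 1 / 2 ^ n) →
          ∫⁻ ω, (hitTime X ω : ℝ≥0∞) ∂μ ≤
              ENNReal.ofReal (C * ((n : ℝ) ^ 2 +
                (2 : ℝ) ^ (m - 2) * (n : ℝ) ^ (m + 1) / ((m - 1).factorial : ℝ))) ∧
          ∫⁻ ω, (hitTime X ω : ℝ≥0∞) ∂μ ≤ ENNReal.ofReal (C * (n : ℝ) ^ (m + 1)) := by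
  refine ⟨2 * (16 * c + 4), by linarith, ?_⟩
  intro n m hn hm hmn Ω _ μ X hμ hX _
  have hmR : (2 : ℝ) ≤ m := by exact_mod_cast hm
  have hmnR : 2 * (m : ℝ) ≤ n := by exact_mod_cast hmn.le
  have hnR : (3 : ℝ) ≤ n := by exact_mod_cast hn
  have hn0 : (0 : ℝ) < n := by linarith
  set D : ℝ := (2 : ℝ) ^ (m - 2) * (n : ℝ) ^ (m + 1) / ((m - 1).factorial : ℝ) with hD
  have hD0 : 0 ≤ D := by positivity
  obtain ⟨p, hp⟩ : ∃ p : ℝ, p = (m : ℝ) * (1 / 2) / (c * (n : ℝ)) := ⟨_, rfl⟩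
  rw [← hp] at hX
  have hp0 : 0 < p := by rw [hp]; positivity
  have hp1 : p ≤ 1 := by
    rw [hp, div_le_one (by positivity)]
    nlinarith
  have hum : uu n m m = (m.factorial : ℝ) / (2 ^ (m - 1) * n ^ m) := if_pos le_rfl
  have hum0 : 0 < uu n m m := by rw [hum]; positivity
  set K : ℝ := 4 / (p * uu n m m) with hK
  have hK0 : 0 ≤ K := by positivity
  have hKp : K * p * uu n m m = 4 := by rw [hK]; field_simp
  have hKD : K ≤ 16 * c * D := by
    obtain ⟨k, rfl⟩ : ∃ k, m = k + 2 := ⟨m - 2, by omega⟩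
    have : K = 16 * c * D / (((k + 2 : ℕ) : ℝ) * ((k + 2 : ℕ) : ℝ)) := by
      rw [hK, hD, hum, hp]
      have e1 : k + 2 - 1 = k + 1 := rfl
      have e2 : k + 2 - 2 = k := rfl
      rw [e1, e2, Nat.factorial_succ (k + 1)]
      push_cast
      field_simp
      ring
    rw [this]
    apply div_le_self (by positivity)
    nlinarith
  obtain ⟨L, hL⟩ : ∃ L : ℝ, L = 4 * n / m := ⟨_, rfl⟩
  have hL0 : 0 < L := by rw [hL]; positivity
  have hL2 : L ≤ 2 * n := by
    rw [hL, div_le_iff₀ (by linarith)]; nlinarith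
  have hmn' : m ≤ n := by omega
  have hnn : 0 < n := by omega
  have hpn := pot_nonneg n m K L hK0 hL0.le hnn hmn'
  have bound : ∫⁻ ω, (hitTime X ω : ℝ≥0∞) ∂μ ≤ ENNReal.ofReal ((16 * c + 4) * ((n : ℝ) ^ 2 + D)) := by
    refine hit_bound μ X (Jump n m) p (1 / 2) hX
      (fun s => ENNReal.ofReal (pot n m K L (zeros s.1) s.2)) _ ?_ ?_
    · rintro ⟨x, o⟩
      apply ENNReal.ofReal_le_ofReal
      have hz : (zeros x : ℝ) ≤ n := by
        have := ones_add_zeros x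
        exact_mod_cast (by omega : zeros x ≤ n)
      have hz0 : (0 : ℝ) ≤ zeros x := Nat.cast_nonneg _
      have habs : |(zeros x : ℝ) - m| ≤ n := by rw [abs_le]; constructor <;> linarith
      have h1 : pot n m K L (zeros x) o ≤ K + L * (2 * n) := by
        have hu := mul_nonneg hK0 (uu_nonneg n m (zeros x))
        have h3 : L * |(zeros x : ℝ) - m| ≤ L * n := mul_le_mul_of_nonneg_left habs hL0.le
        have h4 : L * 3 ≤ L * n := mul_le_mul_of_nonneg_left hnR hL0.le
        have h5 : 0 ≤ L * n := by positivity
        cases o <;> simp only [pot] <;> split_ifs <;> nlinarith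
      have h2 : L * (2 * n) ≤ 4 * (n : ℝ) ^ 2 := by nlinarith
      have h6 : 0 ≤ 16 * c * (n : ℝ) ^ 2 := by positivity
      show pot n m K L (zeros x) o ≤ _
      nlinarith
    · rintro ⟨x, o⟩ hx
      rw [trans_sum hnn (Jump n m) p (1 / 2) hp0.le hp1 (by norm_num) (by norm_num)
        (fun x o => pot n m K L (zeros x) o) (fun x o => hpn _ _)]
      have hd := pot_drift c hc hn hm hmn p K L hp hL hK0 hKp x o hx
      rw [← ENNReal.ofReal_one, ← ENNReal.ofReal_add zero_le_one]
      · exact ENNReal.ofReal_le_ofReal hd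
      · refine div_nonneg (Finset.sum_nonneg fun v _ => ?_) hn0.le
        refine add_nonneg (mul_nonneg ?_ (hpn _ _)) (mul_nonneg ?_ (hpn _ _)) <;>
          cases o <;> simp only [sw] <;> linarith
  have hn2 : (n : ℝ) ^ 2 ≤ (n : ℝ) ^ (m + 1) := pow_le_pow_right₀ (by linarith) (by omega)
  have hDn : D ≤ (n : ℝ) ^ (m + 1) := by
    rw [hD, div_le_iff₀ (by positivity), mul_comm]
    apply mul_le_mul_of_nonneg_left _ (by positivity)
    have := two_pow_le_fact (m - 1)
    have h2 : m - 1 - 1 = m - 2 := by omega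
    rw [h2] at this
    exact_mod_cast this
  refine ⟨bound.trans (ENNReal.ofReal_le_ofReal ?_), bound.trans (ENNReal.ofReal_le_ofReal ?_)⟩
  · have : 0 ≤ (n : ℝ) ^ 2 + D := by positivity
    nlinarith
  · nlinarith
end MMAHHStmt
end

section
/- Average time spent in the slope towards a local maximum of Jump_m. There is an absolute constant C > 0 with the following property. Let n ≥ 3, let m be an integer with 1 < m < n/2, and let p, q ∈ (0,1) satisfy (m/(2(n − 2m)))·(q + 4/n) ≥ p. Consider the MMAHH with acceptance operators OI and AM on f = Jump_m, started from any x_0 ∈ {0,1}^n with ‖x_0‖₁ < n − m and any s_0 ∈ {OI, AM}, and let T_0 = inf{t ≥ 0 : ‖x_t‖₁ = n − m}. Then E[T_0] ≤ C·(n − ‖x_0‖₁)·(1 + p·n)·(1/p + 1/q). In particular, if ‖x_0‖₁ = n − m − 1 then E[T_0] ≤ C·(m + 1)·(1 + p·n)·(1/p + 1/q). -/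
open MeasureTheory
open scoped ENNReal NNReal

namespace MMAHHStmt

instance : Fintype Op := ⟨{Op.OI, Op.AM}, by intro x; cases x <;> simp⟩

instance : MeasurableSingletonClass Op := ⟨fun _ => trivial⟩

/-- histories up to time `t` -/
def Hist {Ω S : Type*} (X : ℕ → Ω → S) (t : ℕ) (σ : ℕ → S) : Set Ω :=
  {ω | ∀ i ≤ t, X i ω = σ i}

/-- target avoided on `[t, t+k]` -/
def Avoid {Ω S : Type*} (X : ℕ → Ω → S) (G : Set S) (t k : ℕ) : Set Ω :=
  {ω | ∀ i, t ≤ i → i ≤ t + k → X i ω ∉ G}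

theorem claim_aux {Ω S : Type*} [MeasurableSpace Ω] [Fintype S] [MeasurableSpace S]
    [MeasurableSingletonClass S] (μ : Measure Ω) (X : ℕ → Ω → S) (hX : ∀ t, Measurable (X t))
    (P : S → S → ℝ≥0∞)
    (hP : ∀ (t : ℕ) (σ : ℕ → S) (s' : S),
      μ {ω | (∀ i ≤ t, X i ω = σ i) ∧ X (t + 1) ω = s'}
        = μ {ω | ∀ i ≤ t, X i ω = σ i} * P (σ t) s')
    (G : Set S) (V : S → ℝ≥0∞) (hV : ∀ s ∉ G, 1 + ∑ s', P s s' * V s' ≤ V s) (N : ℕ) :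
    ∀ (t : ℕ) (σ : ℕ → S),
      ∑ k ∈ Finset.range N, μ (Hist X t σ ∩ Avoid X G t k) ≤ μ (Hist X t σ) * V (σ t) := by
  classical
  induction N with
  | zero => intro t σ; simp
  | succ N ih =>
    intro t σ
    by_cases hG : σ t ∈ G
    · have : ∀ k, Hist X t σ ∩ Avoid X G t k = ∅ := by
        intro k
        ext ω
        simp only [Set.mem_inter_iff, Set.mem_empty_iff_false, iff_false, not_and]
        intro h1 h2
        exact h2 t le_rfl (by omega) ((h1 t le_rfl).symm ▸ hG)
      simp [this]
    · rw [Finset.sum_range_succ']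
      have h0 : μ (Hist X t σ ∩ Avoid X G t 0) ≤ μ (Hist X t σ) * 1 := by
        rw [mul_one]; exact measure_mono Set.inter_subset_left
      have hstep : ∀ k, μ (Hist X t σ ∩ Avoid X G t (k+1)) ≤
          ∑ s', μ (Hist X (t+1) (Function.update σ (t+1) s') ∩ Avoid X G (t+1) k) := by
        intro k
        refine le_trans (measure_mono ?_) (measure_iUnion_fintype_le μ _)
        rintro ω ⟨h1, h2⟩
        refine Set.mem_iUnion.2 ⟨X (t+1) ω, ?_, ?_⟩
        · intro i hi
          rcases Nat.lt_or_ge t i with h | h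
          · obtain rfl : i = t + 1 := by omega
            simp
          · rw [Function.update_of_ne (by omega)]
            exact h1 i h
        · intro i hi hi'
          exact h2 i (by omega) (by omega)
      have hH : ∀ s', μ (Hist X (t+1) (Function.update σ (t+1) s')) =
          μ (Hist X t σ) * P (σ t) s' := by
        intro s'
        rw [Hist, Hist, ← hP t σ s']
        congr 1
        ext ω
        simp only [Set.mem_ofPred_eq]
        constructor
        · intro h
          refine ⟨fun i hi => ?_, by simpa using h (t+1) le_rfl⟩
          have := h i (by omega)
          rwa [Function.update_of_ne (by omega)] at this
        · rintro ⟨h1, h2⟩ i hi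
          rcases Nat.lt_or_ge t i with h | h
          · obtain rfl : i = t + 1 := by omega
            simpa using h2
          · rw [Function.update_of_ne (by omega)]
            exact h1 i h
      calc _ ≤ ∑ k ∈ Finset.range N, (∑ s', μ (Hist X (t+1) (Function.update σ (t+1) s')
                ∩ Avoid X G (t+1) k)) + μ (Hist X t σ) * 1 := by
              gcongr with k hk
              · exact hstep k
        _ = ∑ s', ∑ k ∈ Finset.range N, μ (Hist X (t+1) (Function.update σ (t+1) s')
                ∩ Avoid X G (t+1) k) + μ (Hist X t σ) * 1 := by rw [Finset.sum_comm]
        _ ≤ ∑ s', μ (Hist X t σ) * P (σ t) s' * V s' + μ (Hist X t σ) * 1 := by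
              gcongr with s' hs'
              refine (ih (t+1) (Function.update σ (t+1) s')).trans ?_
              rw [hH]; simp
        _ = μ (Hist X t σ) * (1 + ∑ s', P (σ t) s' * V s') := by
              rw [mul_add, Finset.mul_sum, add_comm]; simp only [mul_assoc]
        _ ≤ _ := by gcongr; exact hV _ hG

theorem hit_bound_s16 {Ω S : Type*} [MeasurableSpace Ω] [Fintype S] [MeasurableSpace S]
    [MeasurableSingletonClass S] (μ : Measure Ω) [IsProbabilityMeasure μ]
    (X : ℕ → Ω → S) (hX : ∀ t, Measurable (X t))
    (P : S → S → ℝ≥0∞)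
    (hP : ∀ (t : ℕ) (σ : ℕ → S) (s' : S),
      μ {ω | (∀ i ≤ t, X i ω = σ i) ∧ X (t + 1) ω = s'}
        = μ {ω | ∀ i ≤ t, X i ω = σ i} * P (σ t) s')
    (G : Set S) (V : S → ℝ≥0∞) (hV : ∀ s ∉ G, 1 + ∑ s', P s s' * V s' ≤ V s)
    (s0 : S) (h0 : μ {ω | X 0 ω = s0} = 1) (T : Ω → ℝ≥0∞)
    (hT : ∀ ω t, X t ω ∈ G → T ω ≤ (t : ℝ≥0∞)) :
    ∫⁻ ω, T ω ∂μ ≤ V s0 := by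
  classical
  have hmeas : ∀ k, MeasurableSet (Avoid X G 0 k) := by
    intro k
    have : Avoid X G 0 k = ⋂ i, ⋂ (_ : i ≤ k), (X i) ⁻¹' Gᶜ := by
      ext ω; simp [Avoid]
    rw [this]
    exact MeasurableSet.iInter fun i => MeasurableSet.iInter fun _ =>
      hX i (Set.toFinite _).measurableSet
  have hpt : ∀ ω, T ω ≤ ∑' k, (Avoid X G 0 k).indicator (fun _ => (1 : ℝ≥0∞)) ω := by
    intro ω
    by_cases h : ∃ t, X t ω ∈ G
    · refine (hT ω _ (Nat.find_spec h)).trans ?_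
      refine le_trans ?_ (ENNReal.sum_le_tsum (Finset.range (Nat.find h)))
      rw [Finset.sum_congr rfl (g := fun _ => (1 : ℝ≥0∞))]
      · simp
      · intro k hk
        rw [Set.indicator_of_mem]
        intro i _ hi
        exact Nat.find_min h (by have := Finset.mem_range.1 hk; omega)
    · push Not at h
      have : ∀ k, (Avoid X G 0 k).indicator (fun _ => (1 : ℝ≥0∞)) ω = 1 := by
        intro k
        rw [Set.indicator_of_mem]
        intro i _ _
        exact h i
      simp only [this]
      rw [ENNReal.tsum_const_eq_top_of_ne_zero one_ne_zero]
      exact le_top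
  have hE : Hist X 0 (fun _ => s0) = {ω | X 0 ω = s0} := by
    ext ω; simp [Hist]
  have hEm : MeasurableSet {ω | X 0 ω = s0} := hX 0 (measurableSet_singleton s0)
  calc ∫⁻ ω, T ω ∂μ ≤ ∫⁻ ω, ∑' k, (Avoid X G 0 k).indicator (fun _ => (1 : ℝ≥0∞)) ω ∂μ :=
        lintegral_mono hpt
    _ = ∑' k, μ (Avoid X G 0 k) := by
        rw [lintegral_tsum]
        · congr 1; ext k
          rw [lintegral_indicator (hmeas k)]; simp
        · intro k
          exact (measurable_const.indicator (hmeas k)).aemeasurable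
    _ ≤ V s0 := by
        rw [ENNReal.tsum_eq_iSup_nat]
        refine iSup_le fun N => ?_
        have := claim_aux μ X hX P hP G V hV N 0 (fun _ => s0)
        rw [hE, h0, one_mul] at this
        refine le_trans (le_of_eq ?_) this
        refine Finset.sum_congr rfl fun k _ => ?_
        rw [Set.inter_comm]
        have hc : μ {ω | X 0 ω = s0}ᶜ = 0 := (prob_compl_eq_zero_iff hEm).2 h0
        exact (measure_inter_conull hc).symm

/-! ### The potential -/

/-- slope parameter -/
noncomputable def wP (n q : ℝ) : ℝ := 2 / n + (1 - 2 / n) * q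

/-- scale parameter -/
noncomputable def kP (n p q : ℝ) : ℝ := n * (1 + p / q) / wP n q

/-- potential as a function of the number of zeros -/
noncomputable def hP (n p q y : ℝ) : Op → ℝ
  | Op.OI => kP n p q * wP n q * y
  | Op.AM => kP n p q * ((1 - 2 / n) * q) * y + (1 / q + kP n p q)

theorem wP_pos {n q : ℝ} (hn : 3 ≤ n) (hq : 0 < q) : 0 < wP n q := by
  have : 0 < 2 / n := by positivity
  have : 2 / n ≤ 1 := by rw [div_le_one (by linarith)]; linarith
  unfold wP
  have := mul_nonneg (sub_nonneg.2 this) hq.le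
  linarith

theorem kP_pos {n p q : ℝ} (hn : 3 ≤ n) (hp : 0 < p) (hq : 0 < q) : 0 < kP n p q := by
  have := wP_pos hn hq
  unfold kP; positivity

theorem hP_nonneg {n p q y : ℝ} (hn : 3 ≤ n) (hp : 0 < p) (hq : 0 < q) (hy : 0 ≤ y) (s : Op) :
    0 ≤ hP n p q y s := by
  have h1 := wP_pos hn hq
  have h2 := kP_pos hn hp hq
  have : 2 / n ≤ 1 := by rw [div_le_one (by linarith)]; linarith
  have h3 := sub_nonneg.2 this
  cases s <;> simp only [hP] <;> positivity

theorem drift_AM {n p q y : ℝ} (hn : 3 ≤ n) (hq : 0 < q) :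
    1 + (q * (((n - y) * hP n p q (y + 1) Op.OI + y * hP n p q (y - 1) Op.OI) / n)
      + (1 - q) * (((n - y) * hP n p q (y + 1) Op.AM + y * hP n p q (y - 1) Op.AM) / n))
      ≤ hP n p q y Op.AM := by
  apply le_of_eq
  simp only [hP]
  generalize kP n p q = k
  unfold wP
  field_simp
  ring

theorem drift_OI {n m p q y : ℝ} (hn : 3 ≤ n) (hm : 2 ≤ m) (hmn : 2 * m + 1 ≤ n)
    (hp : 0 < p) (hq : 0 < q) (hq1 : q < 1) (hy : m + 1 ≤ y)
    (hc : p ≤ (m / (2 * (n - 2 * m))) * (q + 4 / n)) :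
    1 + ((1 - p) * (((n - y) * hP n p q y Op.OI + y * hP n p q (y - 1) Op.OI) / n)
      + p * (((n - y) * hP n p q y Op.AM + y * hP n p q (y - 1) Op.AM) / n))
      ≤ hP n p q y Op.OI := by
  have hw := wP_pos hn hq
  have hk := kP_pos hn hp hq
  have hn0 : (0:ℝ) < n := by linarith
  have hkw : kP n p q * wP n q = n * (1 + p / q) := by
    unfold kP; field_simp
  have hc' : p * (2 * (n - 2 * m)) ≤ m * (q + 4 / n) := by
    have : 0 < 2 * (n - 2 * m) := by linarith
    calc _ ≤ (m / (2 * (n - 2 * m))) * (q + 4 / n) * (2 * (n - 2 * m)) := by gcongr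
      _ = _ := by rw [mul_right_comm, div_mul_cancel₀ _ this.ne']
  have key : wP n q ≤ y * wP n q + 2 * (1 - 1 / n) * p * y - p * n := by
    obtain ⟨i, hi⟩ : ∃ i, i = 1 / n := ⟨_, rfl⟩
    have hin : i * n = 1 := by rw [hi]; field_simp
    have hi0 : 0 < i := by rw [hi]; positivity
    have e1 : (4 : ℝ) / n = 4 * i := by rw [hi]; ring
    have e2 : (2 : ℝ) / n = 2 * i := by rw [hi]; ring
    have hi3 : 3 * i ≤ 1 := by nlinarith
    unfold wP at hw ⊢
    rw [e1] at hc'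
    rw [e2] at hw ⊢
    rw [← hi]
    have h1 : (m + 1) * (2 * i + (1 - 2 * i) * q + 2 * (1 - i) * p)
        ≤ y * (2 * i + (1 - 2 * i) * q + 2 * (1 - i) * p) := by
      apply mul_le_mul_of_nonneg_right hy
      have : 0 ≤ (1 - i) * p := mul_nonneg (by linarith) hp.le
      linarith
    have hmi : 2 * m * i ≤ 1 - i := by nlinarith
    have h2 : 0 ≤ p * ((1 - i) - 2 * m * i) := mul_nonneg hp.le (by linarith)
    have h3 : 0 ≤ q * ((1 - i) - 2 * m * i) := mul_nonneg hq.le (by linarith)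
    have h4 : 0 ≤ q * (m - 2) := mul_nonneg hq.le (by linarith)
    have h5 : 0 ≤ p * (1 - 3 * i) := mul_nonneg hp.le (by linarith)
    have h6 : 0 ≤ q * (1 - 3 * i) := mul_nonneg hq.le (by linarith)
    have h7 : 0 ≤ q * i := by positivity
    nlinarith
  have hmul := mul_le_mul_of_nonneg_left key hk.le
  rw [hkw] at hmul
  have heq : hP n p q y Op.OI - ((1 - p) * (((n - y) * hP n p q y Op.OI
        + y * hP n p q (y - 1) Op.OI) / n)
      + p * (((n - y) * hP n p q y Op.AM + y * hP n p q (y - 1) Op.AM) / n))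
      = kP n p q * (y * wP n q + 2 * (1 - 1 / n) * p * y - p * n) / n - p / q := by
    simp only [hP]
    generalize kP n p q = k
    unfold wP
    field_simp
    ring
  have : 1 + p / q ≤ kP n p q * (y * wP n q + 2 * (1 - 1 / n) * p * y - p * n) / n := by
    rw [le_div_iff₀ hn0]; linarith
  linarith

theorem hP_le {n m p q y : ℝ} (hn : 3 ≤ n) (hm : 2 ≤ m) (hmn : 2 * m + 1 ≤ n)
    (hp : 0 < p) (hq : 0 < q) (hy : m + 1 ≤ y)
    (hc : p ≤ (m / (2 * (n - 2 * m))) * (q + 4 / n)) (s : Op) :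
    hP n p q y s ≤ 4 * y * (1 + p * n) * (1 / p + 1 / q) := by
  have hw := wP_pos hn hq
  have hk := kP_pos hn hp hq
  have hn0 : (0:ℝ) < n := by linarith
  have hkw : kP n p q * wP n q = n * (1 + p / q) := by
    unfold kP; field_simp
  have hc' : p * (2 * (n - 2 * m)) ≤ m * (q + 4 / n) := by
    have : 0 < 2 * (n - 2 * m) := by linarith
    calc _ ≤ (m / (2 * (n - 2 * m))) * (q + 4 / n) * (2 * (n - 2 * m)) := by gcongr
      _ = _ := by rw [mul_right_comm, div_mul_cancel₀ _ this.ne']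
  obtain ⟨R, hR⟩ : ∃ R, R = 1 / p + 1 / q := ⟨_, rfl⟩
  have hR0 : 0 < R := by rw [hR]; positivity
  have hA : n * (1 + p / q) = n * p * R := by rw [hR]; field_simp
  have hAle : n * p * R ≤ (1 + p * n) * R := by nlinarith
  have hn3 : 1 / n ≤ 1 / 3 := by gcongr
  have hnp : n * p ≤ 3 / 2 * m * (1 + p * n) * wP n q := by
    have h1 : q / 2 + 2 / n ≤ 3 / 2 * wP n q := by
      unfold wP
      have e2 : (2 : ℝ) / n = 2 * (1 / n) := by ring
      have : 0 < 1 / n := by positivity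
      rw [e2]; nlinarith
    have h2 : 2 / n ≤ wP n q := by
      unfold wP
      have : 0 ≤ (1 - 2 / n) * q := mul_nonneg (by
        have e2 : (2 : ℝ) / n = 2 * (1 / n) := by ring
        rw [e2]; linarith) hq.le
      linarith
    have h3 : p * (n - 2 * m) ≤ m * (3 / 2 * wP n q) := by
      have : m * (q / 2 + 2 / n) ≤ m * (3 / 2 * wP n q) := by gcongr
      have e : m * (q + 4 / n) = 2 * (m * (q / 2 + 2 / n)) := by ring
      linarith
    have h4 : 2 * m * p ≤ m * (p * n) * wP n q := by
      calc 2 * m * p = m * (p * n) * (2 / n) := by field_simp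
        _ ≤ _ := by gcongr
    have h5 : 0 ≤ m * (p * n) * wP n q := by positivity
    nlinarith
  have hkle : kP n p q ≤ 3 / 2 * m * (1 + p * n) * R := by
    unfold kP
    rw [hA, div_le_iff₀ hw]
    calc n * p * R ≤ 3 / 2 * m * (1 + p * n) * wP n q * R := by gcongr
      _ = _ := by ring
  have hU : 0 < (1 + p * n) * R := by positivity
  rw [← hR]
  have hq' : 1 / q ≤ (1 + p * n) * R := by
    have : 1 / q ≤ R := by rw [hR]; have : 0 < 1 / p := by positivity
                           linarith
    have h : 0 ≤ p * n * R := by positivity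
    nlinarith
  have hAy : kP n p q * wP n q * y ≤ (1 + p * n) * R * y := by
    rw [hkw, hA]; exact mul_le_mul_of_nonneg_right hAle (by linarith)
  obtain ⟨U, hUe⟩ : ∃ U, U = (1 + p * n) * R := ⟨_, rfl⟩
  have e1 : 3 / 2 * m * (1 + p * n) * R = 3 / 2 * m * U := by rw [hUe]; ring
  have e2 : 4 * y * (1 + p * n) * R = 4 * y * U := by rw [hUe]; ring
  rw [e1] at hkle
  rw [e2]
  rw [← hUe] at hU hq' hAy
  cases s
  · simp only [hP]
    nlinarith
  · simp only [hP]
    have : kP n p q * ((1 - 2 / n) * q) * y ≤ kP n p q * wP n q * y := by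
      have : (1 - 2 / n) * q ≤ wP n q := by
        unfold wP; have : 0 < 2 / n := by positivity
        linarith
      have hy0 : 0 ≤ y := by linarith
      gcongr
    nlinarith

/-! ### The chain -/

theorem ones_flip_false {n : ℕ} (x : Point n) (v : Fin n) (h : x v = false) :
    ones (flipBit x v) = ones x + 1 := by
  unfold ones
  have : (Finset.univ.filter fun i => flipBit x v i = true)
      = insert v (Finset.univ.filter fun i => x i = true) := by
    ext i
    by_cases hi : i = v
    · subst hi; simp [flipBit, h]
    · have hfi : flipBit x v i = x i := Function.update_of_ne hi _ _
      rw [Finset.mem_insert, Finset.mem_filter, Finset.mem_filter, hfi]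
      simp [hi]
  rw [this, Finset.card_insert_of_notMem (by simp [h])]

theorem ones_flip_true {n : ℕ} (x : Point n) (v : Fin n) (h : x v = true) :
    ones (flipBit x v) + 1 = ones x := by
  have := ones_flip_false (flipBit x v) v (by simp [flipBit, h])
  rw [← this]
  congr 1
  simp [flipBit]

theorem ones_le {n : ℕ} (x : Point n) : ones x ≤ n := by
  unfold ones
  exact (Finset.card_le_univ _).trans (by simp)

theorem sum_ite {n : ℕ} (x : Point n) (a b : ℝ) :
    ∑ v, (if x v = true then a else b) = (n - ((n:ℝ) - ones x)) * a + ((n:ℝ) - ones x) * b := by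
  have h1 : ((Finset.univ.filter fun i => x i = true).card : ℝ) = ones x := rfl
  have h2 : ((Finset.univ.filter fun i => ¬ x i = true).card : ℝ) = (n:ℝ) - ones x := by
    have := Finset.card_filter_add_card_filter_not (s := (Finset.univ : Finset (Fin n)))
      (fun i => x i = true)
    rw [Finset.card_univ, Fintype.card_fin] at this
    rw [← h1, eq_sub_iff_add_eq, add_comm]
    exact_mod_cast this
  rw [Finset.sum_ite, Finset.sum_const, Finset.sum_const, nsmul_eq_mul, nsmul_eq_mul, h1, h2]
  ring

theorem sum_moveProb {n : ℕ} (f : Point n → ℝ) (op : Op) (x : Point n) (g : Point n → ℝ≥0∞) :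
    ∑ x', moveProb f op x x' * g x' = (∑ v, g (movedPoint f op x v)) / n := by
  classical
  rw [← Finset.sum_fiberwise Finset.univ (fun v => movedPoint f op x v)
    (fun v => g (movedPoint f op x v)), div_eq_mul_inv, Finset.sum_mul]
  refine Finset.sum_congr rfl fun x' _ => ?_
  have : ∑ v ∈ Finset.univ.filter (fun v => movedPoint f op x v = x'),
      g (movedPoint f op x v) = (Finset.univ.filter (fun v => movedPoint f op x v = x')).card
        * g x' := by
    rw [← nsmul_eq_mul, ← Finset.sum_const]
    refine Finset.sum_congr rfl fun v hv => ?_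
    rw [(Finset.mem_filter.1 hv).2]
  rw [this, moveProb, div_eq_mul_inv]
  convert mul_right_comm _ _ _

/-- The sum over successor states. -/
theorem sum_trans {n : ℕ} (f : Point n → ℝ) (p q : ℝ) (x : Point n) (op : Op)
    (V : Point n × Op → ℝ≥0∞) :
    ∑ s', mmahhTrans f p q (x, op) s' * V s' =
      switchProb p q op Op.OI * ((∑ v, V (movedPoint f op x v, Op.OI)) / n) +
      switchProb p q op Op.AM * ((∑ v, V (movedPoint f op x v, Op.AM)) / n) := by
  rw [Fintype.sum_prod_type_right]
  have : (Finset.univ : Finset Op) = {Op.OI, Op.AM} := rfl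
  rw [this, Finset.sum_pair (by decide)]
  congr 1 <;>
  · rw [← sum_moveProb f op x (fun x' => V (x', _)), Finset.mul_sum]
    refine Finset.sum_congr rfl fun x' _ => ?_
    simp only [mmahhTrans]
    ring

open Classical in
/-- The potential on states. -/
noncomputable def VP (n m : ℕ) (p q : ℝ) (s : Point n × Op) : ℝ≥0∞ :=
  if ones s.1 < n - m then ENNReal.ofReal (hP n p q ((n:ℝ) - ones s.1) s.2)
  else if ones s.1 = n - m then 0 else ⊤

theorem VP_le {n m : ℕ} {p q : ℝ} (x : Point n) (op : Op) (h : ones x ≤ n - m) :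
    VP n m p q (x, op) ≤ ENNReal.ofReal (hP n p q ((n:ℝ) - ones x) op) := by
  unfold VP
  split_ifs with h1 h2
  · exact le_rfl
  · exact zero_le
  · exact absurd (lt_of_le_of_ne h h2) h1

theorem moved_bound {n m : ℕ} {p q : ℝ} (hn : 3 ≤ n) (hp : 0 < p) (hq : 0 < q)
    (x : Point n) (hx : ones x < n - m) (op op' : Op) :
    (∑ v, VP n m p q (movedPoint (Jump n m) op x v, op')) / n ≤
      ENNReal.ofReal (((n - ((n:ℝ) - ones x)) *
        hP n p q (match op with | Op.OI => (n:ℝ) - ones x | Op.AM => (n:ℝ) - ones x + 1) op' +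
        ((n:ℝ) - ones x) * hP n p q ((n:ℝ) - ones x - 1) op') / n) := by
  have hn' : (3:ℝ) ≤ n := by exact_mod_cast hn
  have hxn : (ones x : ℝ) + 1 ≤ n := by
    have : ones x + 1 ≤ n := by omega
    exact_mod_cast this
  rw [ENNReal.ofReal_div_of_pos (by linarith), ENNReal.ofReal_natCast, ← sum_ite,
    ENNReal.ofReal_sum_of_nonneg]
  · gcongr with v _
    by_cases hv : x v = true
    · rw [if_pos hv]
      have hf := ones_flip_true x v hv
      have hf' : (ones (flipBit x v) : ℝ) + 1 = ones x := by exact_mod_cast hf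
      cases op
      · have : ¬ Jump n m x < Jump n m (flipBit x v) := by
          unfold Jump
          rw [if_pos (Or.inl hx.le), if_pos (Or.inl (by omega))]
          linarith
        simp only [movedPoint, if_neg this]
        exact VP_le x op' hx.le
      · simp only [movedPoint]
        refine (VP_le _ op' (by omega)).trans (le_of_eq ?_)
        rw [← hf']; congr 2; ring
    · rw [if_neg hv]
      have hf := ones_flip_false x v (by simpa using hv)
      have hf' : (ones (flipBit x v) : ℝ) = ones x + 1 := by exact_mod_cast hf
      have hmv : movedPoint (Jump n m) op x v = flipBit x v := by
        cases op
        · have : Jump n m x < Jump n m (flipBit x v) := by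
            unfold Jump
            rw [if_pos (Or.inl hx.le), if_pos (Or.inl (by omega))]
            linarith
          simp only [movedPoint, if_pos this]
        · rfl
      rw [hmv]
      refine (VP_le _ op' (by omega)).trans (le_of_eq ?_)
      rw [hf']; congr 2; ring
  · intro v _
    split_ifs
    · apply hP_nonneg hn' hp hq
      cases op <;> simp only <;> linarith
    · exact hP_nonneg hn' hp hq (by linarith) _

theorem drift_V {n m : ℕ} {p q : ℝ} (hn : 3 ≤ n) (hm : 1 < m) (hmn : 2 * m < n)
    (hp : 0 < p) (hp1 : p < 1) (hq : 0 < q) (hq1 : q < 1)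
    (hc : p ≤ ((m : ℝ) / (2 * ((n : ℝ) - 2 * (m : ℝ)))) * (q + 4 / (n : ℝ)))
    (s : Point n × Op) (hs : ones s.1 ≠ n - m) :
    1 + ∑ s', mmahhTrans (Jump n m) p q s s' * VP n m p q s' ≤ VP n m p q s := by
  obtain ⟨x, op⟩ := s
  simp only at hs
  by_cases hx : ones x < n - m
  · have hn' : (3:ℝ) ≤ n := by exact_mod_cast hn
    have hm' : (2:ℝ) ≤ m := by exact_mod_cast hm
    have hmn' : 2 * (m:ℝ) + 1 ≤ n := by exact_mod_cast hmn
    have hy : (m:ℝ) + 1 ≤ (n:ℝ) - ones x := by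
      have : m + 1 + ones x ≤ n := by omega
      have : (m:ℝ) + 1 + ones x ≤ n := by exact_mod_cast this
      linarith
    rw [sum_trans]
    have hO := moved_bound hn hp hq x hx op Op.OI
    have hA := moved_bound hn hp hq x hx op Op.AM
    have hV : VP n m p q (x, op) = ENNReal.ofReal (hP n p q ((n:ℝ) - ones x) op) := by
      simp [VP, hx]
    rw [hV]
    have hx0 : (0:ℝ) ≤ ones x := by positivity
    have hnn : ∀ z : ℝ, 0 ≤ z → ∀ o, 0 ≤ ((n - ((n:ℝ) - ones x)) * hP n p q z o +
        ((n:ℝ) - ones x) * hP n p q ((n:ℝ) - ones x - 1) o) / n := by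
      intro z hz o
      have h1 := hP_nonneg hn' hp hq hz o
      have h2 := hP_nonneg hn' hp hq (y := (n:ℝ) - ones x - 1) (by linarith) o
      have h3 : 0 ≤ (n:ℝ) - ones x := by linarith
      have h4 : 0 ≤ (n:ℝ) - ((n:ℝ) - ones x) := by linarith
      positivity
    cases op
    · simp only at hO hA
      refine le_trans (add_le_add_right (add_le_add (mul_le_mul_right hO _)
        (mul_le_mul_right hA _)) 1) ?_
      simp only [switchProb]
      have n1 := hnn ((n:ℝ) - ones x) (by linarith) Op.OI
      have n2 := hnn ((n:ℝ) - ones x) (by linarith) Op.AM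
      have hp' : 0 ≤ 1 - p := by linarith
      rw [← ENNReal.ofReal_one, ← ENNReal.ofReal_mul hp', ← ENNReal.ofReal_mul hp.le,
        ← ENNReal.ofReal_add (by positivity) (by positivity),
        ← ENNReal.ofReal_add (by positivity) (by positivity)]
      exact ENNReal.ofReal_le_ofReal (drift_OI hn' hm' hmn' hp hq hq1 hy hc)
    · simp only at hO hA
      refine le_trans (add_le_add_right (add_le_add (mul_le_mul_right hO _)
        (mul_le_mul_right hA _)) 1) ?_
      simp only [switchProb]
      have n1 := hnn ((n:ℝ) - ones x + 1) (by linarith) Op.OI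
      have n2 := hnn ((n:ℝ) - ones x + 1) (by linarith) Op.AM
      have hp' : 0 ≤ 1 - q := by linarith
      rw [← ENNReal.ofReal_one, ← ENNReal.ofReal_mul hp', ← ENNReal.ofReal_mul hq.le,
        ← ENNReal.ofReal_add (by positivity) (by positivity),
        ← ENNReal.ofReal_add (by positivity) (by positivity)]
      exact ENNReal.ofReal_le_ofReal (drift_AM hn' hq)
  · simp [VP, hx, hs]

/-- Average time spent in the slope towards a local maximum of `Jump_m`
(Lemma 10 of the paper). -/
theorem avg_time_slope :
    ∃ C : ℝ, 0 < C ∧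
      ∀ (n m : ℕ) (p q : ℝ), 3 ≤ n → 1 < m → 2 * m < n →
        0 < p → p < 1 → 0 < q → q < 1 →
        p ≤ ((m : ℝ) / (2 * ((n : ℝ) - 2 * (m : ℝ)))) * (q + 4 / (n : ℝ)) →
        ∀ (Ω : Type) [MeasurableSpace Ω] (μ : Measure Ω) (X : ℕ → Ω → Point n × Op),
          IsProbabilityMeasure μ →
          IsMMAHH μ X (Jump n m) p q →
          ∀ (x0 : Point n) (s0 : Op), ones x0 < n - m →
            μ {ω | X 0 ω = (x0, s0)} = 1 →
            (∫⁻ ω, ((⨅ t ∈ {t : ℕ | ones (X t ω).1 = n - m}, (t : ℕ∞)) : ℝ≥0∞) ∂μ ≤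
              ENNReal.ofReal (C * ((n : ℝ) - (ones x0 : ℝ)) * (1 + p * (n : ℝ)) *
                (1 / p + 1 / q))) ∧
            (ones x0 = n - m - 1 →
              ∫⁻ ω, ((⨅ t ∈ {t : ℕ | ones (X t ω).1 = n - m}, (t : ℕ∞)) : ℝ≥0∞) ∂μ ≤
                ENNReal.ofReal (C * ((m : ℝ) + 1) * (1 + p * (n : ℝ)) *
                  (1 / p + 1 / q))) := by
  refine ⟨4, by norm_num, ?_⟩
  intro n m p q hn hm hmn hp hp1 hq hq1 hc Ω _ μ X hμ hX x0 s0 hx0 hinit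
  have hn' : (3:ℝ) ≤ n := by exact_mod_cast hn
  have hm' : (2:ℝ) ≤ m := by exact_mod_cast hm
  have hmn' : 2 * (m:ℝ) + 1 ≤ n := by exact_mod_cast hmn
  have hy : (m:ℝ) + 1 ≤ (n:ℝ) - ones x0 := by
    have : m + 1 + ones x0 ≤ n := by omega
    have : (m:ℝ) + 1 + ones x0 ≤ n := by exact_mod_cast this
    linarith
  have main : ∫⁻ ω, ((⨅ t ∈ {t : ℕ | ones (X t ω).1 = n - m}, (t : ℕ∞)) : ℝ≥0∞) ∂μ ≤
      ENNReal.ofReal (4 * ((n : ℝ) - (ones x0 : ℝ)) * (1 + p * (n : ℝ)) * (1 / p + 1 / q)) := by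
    refine (hit_bound_s16 μ X hX.1 (mmahhTrans (Jump n m) p q) hX.2 {s | ones s.1 = n - m}
      (VP n m p q) (fun s hs => drift_V hn hm hmn hp hp1 hq hq1 hc s hs) (x0, s0) hinit _
      ?_).trans ?_
    · intro ω t ht
      exact (iInf₂_le t ht).trans (by simp)
    · refine (VP_le x0 s0 hx0.le).trans (ENNReal.ofReal_le_ofReal ?_)
      exact hP_le hn' hm' hmn' hp hq hy hc s0
  refine ⟨main, fun h => ?_⟩
  have e : (n:ℝ) - ones x0 = (m:ℝ) + 1 := by
    have : m + 1 + ones x0 = n := by omega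
    have : (m:ℝ) + 1 + ones x0 = n := by exact_mod_cast this
    linarith
  rw [e] at main
  exact main
end MMAHHStmt
end
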